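/- arXiv:2503.12352 — 8 statements merged into one kernel-verified Lean document; each statement's English description precedes it below -/
import Mathlib

section
/- For an integer N > 1, the sum of W_j over all j ∈ ℤ/Nℤ equals ψ(N) := N·∏_{p | N prime} (1 + 1/p). Equivalently, (∑_{j ∈ ℤ/Nℤ} W_j) · ∏_{p | N prime} p = N · ∏_{p | N prime} (p + 1). -/
/-- `W_j = min {m ∈ ℤ_{>0} | m·j − 1 ∈ (ℤ/Nℤ)ˣ}`. -/
noncomputable def Wfun (N : ℕ) (j : ZMod N) : ℕ :=
  sInf {m : ℕ | 0 < m ∧ IsUnit ((m : ZMod N) * j - 1)}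

open Finset in
/-- A finite form of Kac's lemma: the first return times of an injective self-map to a set that
every orbit meets add up to the cardinality of the whole space. -/
theorem sum_returnTime_eq_card {X : Type*} [Fintype X] {T : X → X} (hT : T.Injective)
    (A : X → Prop) [DecidablePred A] (hA : ∀ x, ∃ m : ℕ, A (T^[m] x)) :
    ∑ x with A x, sInf {m : ℕ | 0 < m ∧ A (T^[m] x)} = Fintype.card X := by
  let h : X → ℕ := fun x ↦ Nat.find (hA x)
  have hreturn (x : X) : sInf {m : ℕ | 0 < m ∧ A (T^[m] x)} = h (T x) + 1 := by
    refine IsLeast.csInf_eq ⟨⟨Nat.succ_pos _, ?_⟩, ?_⟩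
    · rw [Function.iterate_succ_apply]
      exact Nat.find_spec (hA (T x))
    · rintro (_ | m) ⟨h0, hm⟩
      · omega
      · rw [Function.iterate_succ_apply] at hm
        exact Nat.succ_le_succ (Nat.find_min' (hA (T x)) hm)
  have hhit (x : X) (hx : A x) : h x = 0 := (Nat.find_eq_zero _).2 hx
  have hmiss (x : X) (hx : ¬ A x) : h x = h (T x) + 1 := by
    refine (Nat.find_eq_iff _).2 ⟨?_, ?_⟩
    · rw [Function.iterate_succ_apply]
      exact Nat.find_spec (hA (T x))
    · rintro (_ | m) hm hAm
      · exact hx hAm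
      · rw [Function.iterate_succ_apply] at hAm
        exact Nat.find_min (hA (T x)) (Nat.lt_of_succ_lt_succ hm) hAm
  have hshift : ∑ x, h (T x) = ∑ x, h x :=
    (Finite.injective_iff_bijective.1 hT).sum_comp h
  have hsplit := sum_filter_add_sum_filter_not univ A fun x ↦ h (T x) + 1
  have hsplit' := sum_filter_add_sum_filter_not univ A h
  rw [sum_eq_zero fun x hx ↦ hhit x (mem_filter.1 hx).2,
    sum_congr rfl fun x hx ↦ hmiss x (mem_filter.1 hx).2] at hsplit'
  rw [sum_add_distrib (s := univ), hshift, sum_const, smul_eq_mul, mul_one, card_univ] at hsplit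
  simp only [hreturn]
  omega

/-- The set of unimodular pairs in a commutative ring. -/
abbrev UnimodularPair (R : Type*) [CommRing R] : Type _ := {v : R × R // IsCoprime v.1 v.2}

namespace UnimodularPair

/-- The transvection `(x, y) ↦ (x, y + x)` on unimodular pairs. -/
def shear {R : Type*} [CommRing R] (v : UnimodularPair R) : UnimodularPair R :=
  ⟨(v.1.1, v.1.2 + v.1.1), by simpa using v.2.add_mul_left_right 1⟩

theorem shear_injective {R : Type*} [CommRing R] :
    Function.Injective (shear : UnimodularPair R → UnimodularPair R) := by
  rintro ⟨⟨x, y⟩, h⟩ ⟨⟨x', y'⟩, h'⟩ e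
  simp only [shear, Subtype.mk.injEq, Prod.mk.injEq] at e ⊢
  obtain ⟨rfl, e⟩ := e
  exact ⟨rfl, add_right_cancel e⟩

theorem shear_iterate {R : Type*} [CommRing R] (m : ℕ) (v : UnimodularPair R) :
    (shear^[m] v).1 = (v.1.1, v.1.2 + m * v.1.1) := by
  induction m with
  | zero => simp
  | succ m ih =>
    rw [Function.iterate_succ_apply']
    simp only [shear, ih, Prod.mk.injEq, true_and]
    push_cast
    ring

/-- Unimodular pairs with invertible second coordinate, parametrized as `(j * u, -u)`. -/
noncomputable def equivOfIsUnitSnd (R : Type*) [CommRing R] :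
    R × Rˣ ≃ {v : UnimodularPair R // IsUnit v.1.2} where
  toFun w := ⟨⟨(w.1 * w.2, -w.2), isCoprime_one_right.of_isCoprime_of_dvd_right w.2.isUnit.neg.dvd⟩, w.2.isUnit.neg⟩
  invFun v := (v.1.1.1 * ((-v.2.unit)⁻¹ : Rˣ), -v.2.unit)
  left_inv w := by
    have h : -(w.2.isUnit.neg).unit = w.2 := by ext; simp
    ext <;> simp [h]
  right_inv v := by
    ext
    · change v.1.1.1 * ((-v.2.unit)⁻¹ : Rˣ) * ((-v.2.unit : Rˣ) : R) = v.1.1.1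
      rw [Units.inv_mul_cancel_right]
    · simp

theorem card_mul_of_coprime {m n : ℕ} (h : m.Coprime n) :
    Nat.card (UnimodularPair (ZMod (m * n))) =
      Nat.card (UnimodularPair (ZMod m)) * Nat.card (UnimodularPair (ZMod n)) := by
  rw [← Nat.card_prod]
  let e := ZMod.chineseRemainder h
  have key (x y : ZMod (m * n)) :
      IsCoprime x y ↔ IsCoprime (e x).1 (e y).1 ∧ IsCoprime (e x).2 (e y).2 := by
    constructor
    · intro hxy
      exact ⟨hxy.map ((RingHom.fst _ _).comp e.toRingHom),
        hxy.map ((RingHom.snd _ _).comp e.toRingHom)⟩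
    · rintro ⟨⟨a, b, hab⟩, c, d, hcd⟩
      refine ⟨e.symm (a, c), e.symm (b, d), e.injective ?_⟩
      ext <;> simp [hab, hcd]
  refine Nat.card_congr (((Equiv.prodCongr e.toEquiv e.toEquiv).trans
    (Equiv.prodProdProdComm _ _ _ _)).subtypeEquiv
      (q := fun v ↦ IsCoprime v.1.1 v.1.2 ∧ IsCoprime v.2.1 v.2.2) ?_ |>.trans
        (Equiv.subtypeProdEquivProd (p := fun v : ZMod m × ZMod m ↦ IsCoprime v.1 v.2)
          (q := fun v : ZMod n × ZMod n ↦ IsCoprime v.1 v.2)))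
  rintro ⟨x, y⟩
  exact key x y

/-- In a finite local ring, the non-unimodular pairs are the pairs of nonunits. -/
theorem card_add_sq_card_nonunits (R : Type*) [CommRing R] [IsLocalRing R] [Finite R] :
    Nat.card (UnimodularPair R) + Nat.card {x : R // ¬ IsUnit x} ^ 2 = Nat.card R ^ 2 := by
  classical
  have hcop (v : R × R) : ¬ IsCoprime v.1 v.2 ↔ ¬ IsUnit v.1 ∧ ¬ IsUnit v.2 := by
    rw [← not_or, not_iff_not]
    constructor
    · rintro ⟨a, b, hab⟩
      exact (IsLocalRing.isUnit_or_isUnit_of_add_one hab).imp isUnit_of_mul_isUnit_right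
        isUnit_of_mul_isUnit_right
    · rintro (h | h)
      exacts [isCoprime_one_left.of_isCoprime_of_dvd_left h.dvd,
        isCoprime_one_right.of_isCoprime_of_dvd_right h.dvd]
  have hcompl : Nat.card {v : R × R // ¬ IsCoprime v.1 v.2} =
      Nat.card {x : R // ¬ IsUnit x} ^ 2 := by
    rw [sq, ← Nat.card_prod]
    exact Nat.card_congr ((Equiv.subtypeEquivRight hcop).trans (Equiv.subtypeProdEquivProd
      (p := fun x : R ↦ ¬ IsUnit x) (q := fun x : R ↦ ¬ IsUnit x)))
  rw [← hcompl, sq, ← Nat.card_prod, ← Nat.card_sum]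
  exact Nat.card_congr (Equiv.sumCompl _)

theorem isLocalRing_zmod_prime_pow {p : ℕ} (hp : p.Prime) (k : ℕ) :
    IsLocalRing (ZMod (p ^ (k + 1))) := by
  have : Fact (1 < p ^ (k + 1)) := ⟨Nat.one_lt_pow k.succ_ne_zero hp.one_lt⟩
  have : NeZero (p ^ (k + 1)) := ⟨pow_ne_zero _ hp.ne_zero⟩
  refine .of_isUnit_or_isUnit_one_sub_self fun a ↦ ?_
  rw [← ZMod.natCast_zmod_val a]
  by_cases h : p ∣ a.val
  · refine .inr (IsNilpotent.isUnit_one_sub ⟨k + 1, ?_⟩)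
    rw [← Nat.cast_pow, ZMod.natCast_eq_zero_iff]
    exact pow_dvd_pow_of_dvd h _
  · exact .inl ((ZMod.isUnit_iff_coprime _ _).2 (((hp.coprime_iff_not_dvd.2 h).symm).pow_right _))

theorem card_zmod_prime_pow {p : ℕ} (hp : p.Prime) (k : ℕ) :
    Nat.card (UnimodularPair (ZMod (p ^ (k + 1)))) * p =
      (p ^ (k + 1)).totient * (p ^ (k + 1) * (p + 1)) := by
  have : Fact p.Prime := ⟨hp⟩
  have : NeZero (p ^ (k + 1)) := ⟨pow_ne_zero _ hp.ne_zero⟩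
  have := isLocalRing_zmod_prime_pow hp k
  have hunits : Nat.card (ZMod (p ^ (k + 1)))ˣ + Nat.card {x : ZMod (p ^ (k + 1)) // ¬ IsUnit x} =
      p ^ (k + 1) := by
    classical
    have e : (ZMod (p ^ (k + 1)))ˣ ≃ {x : ZMod (p ^ (k + 1)) // IsUnit x} :=
      Equiv.ofInjective _ Units.val_injective
    rw [Nat.card_congr e, ← Nat.card_sum, Nat.card_congr (Equiv.sumCompl _), Nat.card_zmod]
  have hcard := card_add_sq_card_nonunits (ZMod (p ^ (k + 1)))
  rw [Nat.card_zmod] at hcard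
  rw [Nat.card_eq_fintype_card, ZMod.card_units_eq_totient, Nat.totient_prime_pow_succ hp] at hunits
  rw [Nat.totient_prime_pow_succ hp]
  obtain ⟨q, rfl⟩ : ∃ q, p = q + 1 := ⟨p - 1, by have := hp.pos; omega⟩
  have hnon : Nat.card {x : ZMod ((q + 1) ^ (k + 1)) // ¬ IsUnit x} = (q + 1) ^ k := by
    rw [pow_succ] at hunits ⊢
    simp only [Nat.add_sub_cancel] at hunits
    linarith
  rw [hnon] at hcard
  simp only [Nat.add_sub_cancel]
  have : Nat.card (UnimodularPair (ZMod ((q + 1) ^ (k + 1)))) =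
      ((q + 1) ^ k) ^ 2 * (q * (q + 2)) := by
    have : ((q + 1) ^ (k + 1)) ^ 2 = ((q + 1) ^ k) ^ 2 * (q * (q + 2)) + ((q + 1) ^ k) ^ 2 := by
      ring
    omega
  rw [this]
  ring

theorem card_zmod_mul_prod_primeFactors {N : ℕ} (hN : N ≠ 0) :
    Nat.card (UnimodularPair (ZMod N)) * ∏ p ∈ N.primeFactors, p =
      N.totient * (N * ∏ p ∈ N.primeFactors, (p + 1)) := by
  induction N using Nat.recOnPosPrimePosCoprime with
  | zero => exact absurd rfl hN
  | one =>
    have : Unique (UnimodularPair (ZMod 1)) :=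
      ⟨⟨⟨(0, 0), 0, 0, Subsingleton.elim _ _⟩⟩, fun _ ↦ Subsingleton.elim _ _⟩
    simp
  | prime_pow p n hp hn =>
    obtain ⟨k, rfl⟩ := Nat.exists_eq_succ_of_ne_zero hn.ne'
    rw [Nat.primeFactors_prime_pow hn.ne' hp, Finset.prod_singleton, Finset.prod_singleton]
    exact card_zmod_prime_pow hp k
  | coprime a b ha hb hab iha ihb =>
    rw [card_mul_of_coprime hab, Nat.totient_mul hab, hab.primeFactors_mul,
      Finset.prod_union hab.disjoint_primeFactors, Finset.prod_union hab.disjoint_primeFactors,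
      mul_mul_mul_comm, iha (by omega), ihb (by omega)]
    ring

end UnimodularPair

theorem ZMod.exists_isUnit_add_mul_of_isCoprime {N : ℕ} [NeZero N] {x y : ZMod N}
    (h : IsCoprime x y) : ∃ m : ℕ, IsUnit (y + m * x) := by
  refine ⟨∏ q ∈ N.primeFactors with ¬ q ∣ y.val, q, ?_⟩
  set m := ∏ q ∈ N.primeFactors with ¬ q ∣ y.val, q
  have hval : y + m * x = ((y.val + m * x.val : ℕ) : ZMod N) := by simp
  rw [hval, ZMod.isUnit_iff_coprime]
  refine Nat.Coprime.symm (Nat.coprime_of_dvd fun p hp hpN hdvd ↦ ?_)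
  by_cases hpy : p ∣ y.val
  · rcases hp.dvd_mul.1 ((Nat.dvd_add_right hpy).1 hdvd) with hpm | hpx
    · obtain ⟨q, hq, hpq⟩ := (hp.prime.dvd_finsetProd_iff _).1 hpm
      obtain ⟨hqN, hqy⟩ := Finset.mem_filter.1 hq
      exact hqy ((Nat.prime_dvd_prime_iff_eq hp (Nat.prime_of_mem_primeFactors hqN)).1 hpq ▸ hpy)
    · have hmap := h.map (ZMod.castHom hpN (ZMod p))
      rw [← ZMod.natCast_zmod_val x, ← ZMod.natCast_zmod_val y, map_natCast, map_natCast,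
        (ZMod.natCast_eq_zero_iff _ _).2 hpx, (ZMod.natCast_eq_zero_iff _ _).2 hpy] at hmap
      have : Fact p.Prime := ⟨hp⟩
      exact not_isCoprime_zero_zero hmap
  · refine hpy ((Nat.dvd_add_left (Dvd.dvd.mul_right ?_ _)).1 hdvd)
    exact Finset.dvd_prod_of_mem _
      (Finset.mem_filter.2 ⟨Nat.mem_primeFactors.2 ⟨hp, hpN, NeZero.ne N⟩, hpy⟩)

open UnimodularPair in
theorem totient_mul_sum_Wfun (N : ℕ) [NeZero N] :
    N.totient * ∑ j : ZMod N, Wfun N j = Nat.card (UnimodularPair (ZMod N)) := by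
  classical
  have := Fintype.ofFinite (UnimodularPair (ZMod N))
  rw [Nat.card_eq_fintype_card, ← sum_returnTime_eq_card shear_injective
    (fun v : UnimodularPair (ZMod N) ↦ IsUnit v.1.2) fun v ↦ by
      simpa only [shear_iterate] using ZMod.exists_isUnit_add_mul_of_isCoprime v.2]
  rw [Finset.sum_subtype (p := fun v : UnimodularPair (ZMod N) ↦ IsUnit v.1.2) _ (by simp),
    ← (equivOfIsUnitSnd (ZMod N)).sum_comp, Fintype.sum_prod_type, Finset.mul_sum]
  refine Finset.sum_congr rfl fun j _ ↦ ?_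
  have hW (u : (ZMod N)ˣ) :
      sInf {m : ℕ | 0 < m ∧ IsUnit (shear^[m] (equivOfIsUnitSnd (ZMod N) (j, u)).1).1.2} =
        Wfun N j := by
    have hfactor (m : ℕ) : -(u : ZMod N) + m * (j * u) = (m * j - 1) * u := by ring
    simp only [shear_iterate, equivOfIsUnitSnd, Equiv.coe_fn_mk, hfactor, Units.isUnit_mul_units,
      Wfun]
  rw [Finset.sum_congr rfl fun u _ ↦ hW u, Finset.sum_const, Finset.card_univ,
    ZMod.card_units_eq_totient, smul_eq_mul]

/-- For `N > 1`, `∑_{j ∈ ℤ/Nℤ} W_j = ψ(N) = N·∏_{p ∣ N} (1 + 1/p)`, stated equivalently as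
`(∑_{j ∈ ℤ/Nℤ} W_j) · ∏_{p ∣ N} p = N · ∏_{p ∣ N} (p + 1)`. -/
theorem sum_W_eq_psi (N : ℕ) [NeZero N] (hN : 1 < N) :
    (∑ j : ZMod N, Wfun N j) * ∏ p ∈ N.primeFactors, p =
      N * ∏ p ∈ N.primeFactors, (p + 1) := by
  refine Nat.eq_of_mul_eq_mul_left (Nat.totient_pos.2 (Nat.zero_lt_of_lt hN)) ?_
  rw [← mul_assoc, totient_mul_sum_Wfun]
  exact UnimodularPair.card_zmod_mul_prod_primeFactors (NeZero.ne N)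
end

section
/- For an integer N > 1, the sum of W_j over all units j ∈ (ℤ/Nℤ)ˣ equals N. -/
/-- The distance from `u` to the next unit of `ℤ/Nℤ`, going up in steps of one. -/
noncomputable def unitGap (N : ℕ) (u : ZMod N) : ℕ :=
  sInf {m : ℕ | 0 < m ∧ IsUnit (u + m)}

theorem Wfun_neg_inv (N : ℕ) (u : (ZMod N)ˣ) :
    Wfun N ((-u⁻¹ : (ZMod N)ˣ) : ZMod N) = unitGap N u := by
  unfold Wfun unitGap
  congr 1
  ext m
  have h : (m : ZMod N) * ((-u⁻¹ : (ZMod N)ˣ) : ZMod N) - 1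
      = ((-u⁻¹ : (ZMod N)ˣ) : ZMod N) * (u + m) := by
    have := u.inv_mul
    push_cast
    linear_combination this
  simp only [Set.mem_ofPred_eq, h, Units.isUnit_units_mul]

theorem unitGap_mem {N : ℕ} [NeZero N] (u : (ZMod N)ˣ) :
    0 < unitGap N u ∧ IsUnit ((u : ZMod N) + (unitGap N u : ℕ)) :=
  Nat.sInf_mem (s := {m : ℕ | 0 < m ∧ IsUnit ((u : ZMod N) + m)})
    ⟨N, NeZero.pos N, by simp⟩

theorem unitGap_le {N : ℕ} {u : ZMod N} {m : ℕ} (hm : 0 < m) (h : IsUnit (u + m)) :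
    unitGap N u ≤ m :=
  Nat.sInf_le ⟨hm, h⟩

/-- An offset smaller than the gap of its unit is the least offset by which the same element can
be reached from a unit. -/
theorem offset_le_of_add_eq_add {N : ℕ} {u v : (ZMod N)ˣ} {k l : ℕ} (hl : l < unitGap N v)
    (h : (u : ZMod N) + k = v + l) : l ≤ k := by
  by_contra! hlt
  have hu : (v : ZMod N) + (l - k : ℕ) = u := by
    rw [Nat.cast_sub hlt.le]
    linear_combination -h
  have := unitGap_le (Nat.sub_pos_of_lt hlt) (hu ▸ u.isUnit)
  omega

theorem bijective_unit_add_offset (N : ℕ) [NeZero N] :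
    Function.Bijective
      (fun p : Σ u : (ZMod N)ˣ, Fin (unitGap N u) => (p.1 : ZMod N) + (p.2 : ℕ)) := by
  constructor
  · rintro ⟨u, k, hk⟩ ⟨v, l, hl⟩ h
    have h' : (u : ZMod N) + k = v + l := h
    obtain rfl := le_antisymm (offset_le_of_add_eq_add hk h'.symm) (offset_le_of_add_eq_add hl h')
    obtain rfl := Units.ext (add_right_cancel h')
    rfl
  · intro x
    classical
    have hex : ∃ k : ℕ, IsUnit (x - k) :=
      ⟨(x - 1).val, by simp⟩
    obtain ⟨u, hu⟩ := Nat.find_spec hex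
    refine ⟨⟨u, Nat.find hex, ?_⟩, by simp [hu]⟩
    by_contra! hle
    obtain ⟨hpos, hunit⟩ := unitGap_mem u
    refine Nat.find_min hex (Nat.sub_lt (hpos.trans_le hle) hpos) ?_
    rw [Nat.cast_sub hle]
    convert hunit using 1
    rw [hu]
    ring

/-- For `N > 1`, the sum of `W_j` over all units `j ∈ (ℤ/Nℤ)ˣ` equals `N`. -/
theorem sum_W_units_eq (N : ℕ) [NeZero N] (hN : 1 < N) :
    ∑ j : (ZMod N)ˣ, Wfun N (j : ZMod N) = N := by
  calc ∑ j : (ZMod N)ˣ, Wfun N (j : ZMod N)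
      = ∑ u : (ZMod N)ˣ, Wfun N ((-u⁻¹ : (ZMod N)ˣ) : ZMod N) :=
        (Equiv.sum_comp ((Equiv.inv _).trans (Equiv.neg _))
          (fun j : (ZMod N)ˣ => Wfun N (j : ZMod N))).symm
    _ = ∑ u : (ZMod N)ˣ, unitGap N u := by simp only [Wfun_neg_inv]
    _ = Fintype.card (Σ u : (ZMod N)ˣ, Fin (unitGap N u)) := by simp
    _ = N := by rw [Fintype.card_of_bijective (bijective_unit_add_offset N), ZMod.card]
end

section
/- For an integer N > 1, the sum of W_j over all non-unit elements j ∈ ℤ/Nℤ (equivalently, over all j represented by integers with gcd(j, N) > 1) equals ψ(N) − N, where ψ(N) := N·∏_{p | N prime} (1 + 1/p). -/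
/-- The number of pairs of coprime elements of `ℤ/Nℤ`, i.e. Jordan's totient `J₂(N)`. -/
noncomputable def coprimePairCount (N : ℕ) : ℕ :=
  Nat.card {x : ZMod N × ZMod N // IsCoprime x.1 x.2}

theorem IsUnit.isCoprime_left {R : Type*} [CommSemiring R] {x y : R} (h : IsUnit x) :
    IsCoprime x y :=
  isCoprime_one_left.of_isCoprime_of_dvd_left h.dvd

theorem Prod.isCoprime_iff {R S : Type*} [CommSemiring R] [CommSemiring S] {x y : R × S} :
    IsCoprime x y ↔ IsCoprime x.1 y.1 ∧ IsCoprime x.2 y.2 := by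
  constructor
  · intro h
    exact ⟨h.map (RingHom.fst R S), h.map (RingHom.snd R S)⟩
  · rintro ⟨⟨a, b, h⟩, ⟨c, d, h'⟩⟩
    exact ⟨(a, c), (b, d), Prod.ext h h'⟩

theorem RingEquiv.isCoprime_iff {R S : Type*} [CommSemiring R] [CommSemiring S] (e : R ≃+* S)
    {x y : R} : IsCoprime (e x) (e y) ↔ IsCoprime x y := by
  constructor
  · intro h
    simpa using h.map (e.symm : S →+* R)
  · intro h
    exact h.map (e : R →+* S)

theorem coprimePairCount_mul {m n : ℕ} (h : m.Coprime n) :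
    coprimePairCount (m * n) = coprimePairCount m * coprimePairCount n := by
  unfold coprimePairCount
  rw [← Nat.card_prod]
  let e := ZMod.chineseRemainder h
  let f : ZMod (m * n) × ZMod (m * n) ≃ (ZMod m × ZMod m) × (ZMod n × ZMod n) :=
    (e.toEquiv.prodCongr e.toEquiv).trans (Equiv.prodProdProdComm _ _ _ _)
  refine Nat.card_congr ((f.subtypeEquiv (p := fun x => IsCoprime x.1 x.2)
    (q := fun x => IsCoprime x.1.1 x.1.2 ∧ IsCoprime x.2.1 x.2.2) ?_).trans
    (Equiv.subtypeProdEquivProd (p := fun x : ZMod m × ZMod m => IsCoprime x.1 x.2)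
      (q := fun x : ZMod n × ZMod n => IsCoprime x.1 x.2)))
  rintro ⟨a, b⟩
  exact e.isCoprime_iff.symm.trans Prod.isCoprime_iff

theorem ZMod.natCard_isUnit (N : ℕ) [NeZero N] :
    Nat.card {x : ZMod N // IsUnit x} = N.totient := by
  rw [← ZMod.card_units_eq_totient, ← Nat.card_eq_fintype_card]
  exact Nat.card_congr Submonoid.unitsTypeEquivIsUnitSubmonoid.symm.toEquiv

/-- An element of `ℤ/pᵏℤ` and another one are coprime iff one of them is a unit. -/
theorem ZMod.isCoprime_prime_pow_iff {p k : ℕ} (hp : p.Prime) (hk : k ≠ 0)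
    (a b : ZMod (p ^ k)) : IsCoprime a b ↔ IsUnit a ∨ IsUnit b := by
  have : NeZero (p ^ k) := ⟨pow_ne_zero _ hp.ne_zero⟩
  have hunit (x : ZMod (p ^ k)) : IsUnit x ↔ ¬ p ∣ x.val := by
    rw [← ZMod.natCast_zmod_val x, ZMod.isUnit_iff_coprime, ZMod.natCast_zmod_val,
      Nat.coprime_pow_right_iff (Nat.pos_of_ne_zero hk), Nat.coprime_comm,
      hp.coprime_iff_not_dvd]
  constructor
  · intro h
    by_contra! hab
    rw [hunit, hunit, not_not, not_not] at hab
    have : Fact p.Prime := ⟨hp⟩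
    have h' := h.map (ZMod.castHom (dvd_pow_self p hk) (ZMod p))
    rw [← ZMod.natCast_zmod_val a, ← ZMod.natCast_zmod_val b, map_natCast, map_natCast,
      (ZMod.natCast_eq_zero_iff _ _).2 hab.1, (ZMod.natCast_eq_zero_iff _ _).2 hab.2] at h'
    exact not_isCoprime_zero_zero h'
  · rintro (h | h)
    · exact h.isCoprime_left
    · exact h.isCoprime_left.symm

theorem coprimePairCount_prime_pow {p k : ℕ} (hp : p.Prime) :
    coprimePairCount (p ^ (k + 1)) + (p ^ k) ^ 2 = (p ^ (k + 1)) ^ 2 := by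
  have : NeZero (p ^ (k + 1)) := ⟨pow_ne_zero _ hp.ne_zero⟩
  have hnon : Nat.card {x : ZMod (p ^ (k + 1)) // ¬ IsUnit x} = p ^ k := by
    classical
    have h := Fintype.card_subtype_compl (fun x : ZMod (p ^ (k + 1)) => IsUnit x)
    simp only [← Nat.card_eq_fintype_card] at h
    rw [ZMod.natCard_isUnit, Nat.card_zmod,
      Nat.totient_prime_pow_succ hp] at h
    rw [h, pow_succ, ← Nat.mul_sub, Nat.sub_sub_self hp.one_le, mul_one]
  have hcompl : Nat.card {x : ZMod (p ^ (k + 1)) × ZMod (p ^ (k + 1)) // ¬ IsCoprime x.1 x.2}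
      = (p ^ k) ^ 2 := by
    rw [← hnon, sq, ← Nat.card_prod]
    refine Nat.card_congr ((Equiv.subtypeEquivRight fun x => ?_).trans
      (Equiv.subtypeProdEquivProd (p := fun x : ZMod (p ^ (k + 1)) => ¬ IsUnit x)
        (q := fun x : ZMod (p ^ (k + 1)) => ¬ IsUnit x)))
    rw [ZMod.isCoprime_prime_pow_iff hp k.succ_ne_zero, not_or]
  classical
  rw [← hcompl, coprimePairCount, ← Nat.card_sum,
    Nat.card_congr (Equiv.sumCompl fun x : ZMod (p ^ (k + 1)) × ZMod (p ^ (k + 1)) =>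
      IsCoprime x.1 x.2), Nat.card_prod, Nat.card_zmod, sq]

theorem coprimePairCount_mul_prod_primeFactors (N : ℕ) (hN : N ≠ 0) :
    coprimePairCount N * ∏ p ∈ N.primeFactors, p =
      N * N.totient * ∏ p ∈ N.primeFactors, (p + 1) := by
  induction N using Nat.recOnPosPrimePosCoprime with
  | zero => exact absurd rfl hN
  | one =>
    have : Nat.card {x : ZMod 1 × ZMod 1 // IsCoprime x.1 x.2} = 1 :=
      Nat.card_eq_one_iff_unique.2 ⟨inferInstance, ⟨⟨0, 0, 0, rfl⟩⟩⟩
    simp [coprimePairCount, this]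
  | prime_pow p k hp hk =>
    obtain ⟨k, rfl⟩ := Nat.exists_eq_succ_of_ne_zero hk.ne'
    have h := coprimePairCount_prime_pow (k := k) hp
    rw [Nat.primeFactors_prime_pow k.succ_ne_zero hp, Nat.succ_eq_add_one,
      Nat.totient_prime_pow_succ hp, Finset.prod_singleton, Finset.prod_singleton]
    obtain ⟨q, rfl⟩ := Nat.exists_eq_succ_of_ne_zero hp.ne_zero
    rw [Nat.succ_eq_add_one] at *
    rw [Nat.add_sub_cancel]
    zify at h ⊢
    linear_combination ((q : ℤ) + 1) * h
  | coprime a b ha hb hab iha ihb =>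
    rw [coprimePairCount_mul hab, Nat.totient_mul hab, hab.primeFactors_mul,
      Finset.prod_union hab.disjoint_primeFactors, Finset.prod_union hab.disjoint_primeFactors]
    calc _ = (coprimePairCount a * ∏ p ∈ a.primeFactors, p) *
          (coprimePairCount b * ∏ p ∈ b.primeFactors, p) := by ring
      _ = _ := by rw [iha (by lia), ihb (by lia)]; ring

theorem ZMod.exists_isUnit_add_natCast_mul {N : ℕ} [NeZero N] {a b : ZMod N}
    (h : IsCoprime a b) : ∃ t : ℕ, IsUnit (a + t * b) := by
  classical
  refine ⟨∏ p ∈ N.primeFactors with ¬ p ∣ a.val, p, ?_⟩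
  set t := ∏ p ∈ N.primeFactors with ¬ p ∣ a.val, p with ht
  have hcast : a + t * b = ((a.val + t * b.val : ℕ) : ZMod N) := by simp
  rw [hcast, ZMod.isUnit_iff_coprime]
  refine Nat.coprime_of_dvd fun p hp hpab hpN => ?_
  by_cases hpa : p ∣ a.val
  · rcases hp.dvd_mul.1 ((Nat.dvd_add_right hpa).1 hpab) with hpt | hpb
    · obtain ⟨q, hq, hpq⟩ := (hp.prime.dvd_finsetProd_iff _).1 hpt
      rw [Finset.mem_filter, Nat.mem_primeFactors] at hq
      rw [Nat.prime_dvd_prime_iff_eq hp hq.1.1] at hpq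
      exact hq.2 (hpq ▸ hpa)
    · have : Fact p.Prime := ⟨hp⟩
      have h' := h.map (ZMod.castHom hpN (ZMod p))
      rw [← ZMod.natCast_zmod_val a, ← ZMod.natCast_zmod_val b, map_natCast, map_natCast,
        (ZMod.natCast_eq_zero_iff _ _).2 hpa, (ZMod.natCast_eq_zero_iff _ _).2 hpb] at h'
      exact not_isCoprime_zero_zero h'
  · have hpt : p ∣ t := Finset.dvd_prod_of_mem _ (by simp [hp, hpN, hpa, NeZero.ne N])
    exact hpa ((Nat.dvd_add_left (hpt.mul_right _)).1 hpab)

theorem Wfun_spec (N : ℕ) [NeZero N] (j : ZMod N) :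
    0 < Wfun N j ∧ IsUnit ((Wfun N j : ZMod N) * j - 1) :=
  Nat.sInf_mem (s := {m : ℕ | 0 < m ∧ IsUnit ((m : ZMod N) * j - 1)})
    ⟨N, Nat.pos_of_ne_zero (NeZero.ne N), by simp⟩

theorem Wfun_le {N m : ℕ} {j : ZMod N} (hm : 0 < m) (h : IsUnit ((m : ZMod N) * j - 1)) :
    Wfun N j ≤ m :=
  Nat.sInf_le ⟨hm, h⟩

/-- In the parametrization `(u(1 - tj), uj)` of coprime pairs, with `t < W_j`, the parameter `t`
is determined by the pair. -/
theorem le_of_mul_one_sub_eq {N : ℕ} {u v : (ZMod N)ˣ} {j k : ZMod N} {s t : ℕ}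
    (ht : t < Wfun N k) (h₁ : (u : ZMod N) * (1 - s * j) = v * (1 - t * k))
    (h₂ : (u : ZMod N) * j = v * k) :
    t ≤ s := by
  by_contra! hst
  have key : ((t - s : ℕ) : ZMod N) * k - 1 = ((-(v⁻¹ * u) : (ZMod N)ˣ) : ZMod N) := by
    have hu : (u : ZMod N) = v * (1 - (t - s) * k) := by
      linear_combination h₁ + s * h₂
    rw [Nat.cast_sub hst.le, Units.val_neg, Units.val_mul, hu, Units.inv_mul_cancel_left]
    ring
  have := Wfun_le (Nat.sub_pos_of_lt hst) (key ▸ Units.isUnit _)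
  lia

theorem totient_mul_sum_Wfun_s4 (N : ℕ) [NeZero N] :
    N.totient * ∑ j ∈ Finset.univ.filter (fun j : ZMod N => ¬ IsUnit j), Wfun N j =
      Nat.card {x : ZMod N × ZMod N // IsCoprime x.1 x.2 ∧ ¬ IsUnit x.2} := by
  classical
  rw [Nat.card_eq_fintype_card, Fintype.card_subtype, ← ZMod.card_units_eq_totient,
    ← Finset.card_univ]
  have hsigma (S : Finset (ZMod N)) :
      ∑ j ∈ S, Wfun N j = (S.sigma fun j => Finset.range (Wfun N j)).card := by
    simp only [Finset.card_sigma, Finset.card_range]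
  rw [hsigma, ← Finset.card_product]
  refine Finset.card_bij (fun x _ => ((x.1 : ZMod N) * (1 - x.2.2 * x.2.1), x.1 * x.2.1))
    ?_ ?_ ?_
  · rintro ⟨u, j, t⟩ h
    simp only [Finset.mem_product, Finset.mem_univ, Finset.mem_sigma, Finset.mem_filter,
      true_and] at h ⊢
    refine ⟨⟨(u⁻¹ : (ZMod N)ˣ), t * (u⁻¹ : (ZMod N)ˣ), ?_⟩, by simpa using h.1⟩
    linear_combination u.inv_mul
  · rintro ⟨u, j, s⟩ h ⟨v, k, t⟩ h' heq
    simp only [Finset.mem_product, Finset.mem_univ, Finset.mem_sigma, Finset.mem_range,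
      true_and, Prod.mk.injEq] at h h' heq
    obtain rfl : s = t := le_antisymm (le_of_mul_one_sub_eq h.2 heq.1.symm heq.2.symm)
      (le_of_mul_one_sub_eq h'.2 heq.1 heq.2)
    obtain rfl : u = v := Units.ext (by linear_combination heq.1 + s * heq.2)
    obtain rfl : j = k := by simpa using heq.2
    rfl
  · rintro ⟨a, b⟩ h
    simp only [Finset.mem_filter, Finset.mem_univ, true_and] at h
    have hex := ZMod.exists_isUnit_add_natCast_mul h.1
    obtain ⟨u, hu⟩ := Nat.find_spec hex
    have hb : (u : ZMod N) * ((u⁻¹ : (ZMod N)ˣ) * b) = b := u.mul_inv_cancel_left b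
    refine ⟨⟨u, (u⁻¹ : (ZMod N)ˣ) * b, Nat.find hex⟩, ?_, ?_⟩
    · simp only [Finset.mem_product, Finset.mem_univ, Finset.mem_sigma, Finset.mem_filter,
        Finset.mem_range, Units.isUnit_units_mul, true_and]
      refine ⟨h.2, ?_⟩
      by_contra! hle
      obtain ⟨hpos, hunit⟩ := Wfun_spec N ((u⁻¹ : (ZMod N)ˣ) * b)
      refine Nat.find_min hex (Nat.sub_lt (hpos.trans_le hle) hpos) ?_
      have hsub := (u.isUnit.mul hunit).neg
      convert hsub using 1
      rw [Nat.cast_sub hle]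
      linear_combination (Wfun N ((u⁻¹ : (ZMod N)ˣ) * b) : ZMod N) * hb - hu
    · refine Prod.ext ?_ hb
      linear_combination hu - (Nat.find hex : ZMod N) * hb

theorem coprimePairCount_eq_totient_mul (N : ℕ) [NeZero N] :
    coprimePairCount N = N.totient *
      (∑ j ∈ Finset.univ.filter (fun j : ZMod N => ¬ IsUnit j), Wfun N j + N) := by
  classical
  have hunit : Nat.card {x : ZMod N × ZMod N // IsCoprime x.1 x.2 ∧ IsUnit x.2} =
      N * N.totient := by
    rw [← ZMod.natCard_isUnit, ← congrArg (· * _) (Nat.card_zmod N), ← Nat.card_prod]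
    exact Nat.card_congr
      { toFun := fun x => (x.1.1, ⟨x.1.2, x.2.2⟩)
        invFun := fun x => ⟨(x.1, x.2.1), x.2.2.isCoprime_left.symm, x.2.2⟩
        left_inv := fun _ => rfl
        right_inv := fun _ => rfl }
  rw [mul_add, totient_mul_sum_Wfun_s4, mul_comm _ N, ← hunit, coprimePairCount]
  simp only [Nat.card_eq_fintype_card, Fintype.card_subtype]
  rw [add_comm, ← Finset.filter_filter, ← Finset.filter_filter,
    Finset.card_filter_add_card_filter_not]


/-- For `N > 1`, the sum of `W_j` over all non-units `j ∈ ℤ/Nℤ` equals `ψ(N) − N`, where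
`ψ(N) = N·∏_{p ∣ N} (1 + 1/p)`; stated in `ℤ` after multiplying through by `∏_{p ∣ N} p`:
`(∑_{j non-unit} W_j) · ∏_{p ∣ N} p = N·∏_{p ∣ N} (p + 1) − N·∏_{p ∣ N} p`. -/
theorem sum_W_nonunits_eq (N : ℕ) [NeZero N] (hN : 1 < N) :
    ((∑ j ∈ Finset.univ.filter (fun j : ZMod N => ¬ IsUnit j), Wfun N j : ℕ) : ℤ) *
        ∏ p ∈ N.primeFactors, (p : ℤ) =
      (N : ℤ) * ∏ p ∈ N.primeFactors, ((p : ℤ) + 1) -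
        (N : ℤ) * ∏ p ∈ N.primeFactors, (p : ℤ) := by
  have h := coprimePairCount_mul_prod_primeFactors N (NeZero.ne N)
  rw [coprimePairCount_eq_totient_mul] at h
  have hpos : ((N.totient : ℕ) : ℤ) ≠ 0 := by
    exact_mod_cast (Nat.totient_pos.2 (by lia)).ne'
  apply mul_left_cancel₀ hpos
  zify at h
  push_cast
  linear_combination h
end

section
/- Let N > 1, let d > 1 be a divisor of N, and set d' = N/d and d'' = gcd(d, d'). Fix b ∈ (ℤ/d''ℤ)ˣ. Then ∑_{k ∈ K_b} W_{d·k} = d'/d'', where K_b is the set of units k ∈ (ℤ/d'ℤ)ˣ whose image under the natural reduction map (ℤ/d'ℤ)ˣ → (ℤ/d''ℤ)ˣ equals b, and W_{d·k} is evaluated at the class in ℤ/Nℤ of d times any integer lift of k (this class does not depend on the lift). -/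
theorem isUnit_mul_sub_one_iff (d D m : ℕ) [NeZero D] (k : (ZMod D)ˣ) :
    IsUnit ((m : ZMod (d * D)) * ((d * (k : ZMod D).val : ℕ) : ZMod (d * D)) - 1) ↔
      IsUnit ((↑k⁻¹ : ZMod D) - m * d) := by
  have hcast : (m : ZMod (d * D)) * ((d * (k : ZMod D).val : ℕ) : ZMod (d * D)) - 1 =
      ((m * (d * (k : ZMod D).val) - 1 : ℤ) : ZMod (d * D)) := by push_cast; ring
  have hcop : IsCoprime (m * (d * (k : ZMod D).val) - 1 : ℤ) d :=
    ⟨-1, m * (k : ZMod D).val, by ring⟩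
  have hfactor : ((m * (d * (k : ZMod D).val) - 1 : ℤ) : ZMod D) =
      ((-k : (ZMod D)ˣ) : ZMod D) * ((↑k⁻¹ : ZMod D) - m * d) := by
    push_cast
    rw [ZMod.natCast_zmod_val, mul_sub, neg_mul, Units.mul_inv]
    ring
  rw [hcast, ZMod.coe_int_isUnit_iff_isCoprime, isCoprime_comm, Nat.cast_mul,
    IsCoprime.mul_right_iff, and_iff_right hcop, isCoprime_comm,
    ← ZMod.coe_int_isUnit_iff_isCoprime, hfactor, Units.isUnit_units_mul]

/-- The map `x ↦ x + d` is transitive on each fibre of `ℤ/D → ℤ/gcd(d, D)`. -/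
theorem exists_natCast_mul_eq_of_castHom_eq {d D g : ℕ} [NeZero D] (hg : g = Nat.gcd d D)
    (h : g ∣ D) {x y : ZMod D}
    (hxy : ZMod.castHom h (ZMod g) x = ZMod.castHom h (ZMod g) y) :
    ∃ t : ℕ, x = y + t * d := by
  obtain ⟨z, hz⟩ := ZMod.intCast_surjective (x - y)
  have hgz : (g : ℤ) ∣ z := by
    rw [← ZMod.intCast_zmod_eq_zero_iff_dvd, ← map_intCast (ZMod.castHom h (ZMod g)), hz,
      map_sub, hxy, sub_self]
  obtain ⟨c, rfl⟩ := hgz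
  refine ⟨((Nat.gcdA d D * c : ℤ) : ZMod D).val, ?_⟩
  have hbezout : ((g : ℤ) : ZMod D) = d * (Nat.gcdA d D : ZMod D) := by
    rw [hg, Nat.gcd_eq_gcd_ab]
    push_cast
    simp
  rw [ZMod.natCast_zmod_val, ← sub_eq_iff_eq_add', ← hz]
  push_cast at hbezout ⊢
  rw [hbezout]
  ring

theorem card_filter_castHom_eq {D g : ℕ} [NeZero D] (h : g ∣ D) (c : ZMod g) :
    (Finset.univ.filter (fun y : ZMod D => ZMod.castHom h (ZMod g) y = c)).card = D / g := by
  have : NeZero g := ⟨fun h0 => NeZero.ne D (Nat.eq_zero_of_zero_dvd (h0 ▸ h))⟩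
  have hsurj := ZMod.castHom_surjective h
  have hcard : ∀ e : ZMod g,
      (Finset.univ.filter (fun y : ZMod D => ZMod.castHom h (ZMod g) y = e)).card =
      (Finset.univ.filter (fun y : ZMod D => ZMod.castHom h (ZMod g) y = c)).card := by
    intro e
    obtain ⟨a, ha⟩ := hsurj (c - e)
    refine Finset.card_bij (fun y _ => y + a) ?_ ?_ ?_
    · intro y hy
      simp only [Finset.mem_filter_univ] at hy ⊢
      rw [map_add, hy, ha, add_sub_cancel]
    · intro y _ z _ hyz
      exact add_right_cancel hyz
    · intro y hy
      simp only [Finset.mem_filter_univ] at hy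
      refine ⟨y - a, ?_, sub_add_cancel y a⟩
      rw [Finset.mem_filter_univ, map_sub, hy, ha, sub_sub_cancel]
  have hsum := Finset.card_eq_sum_card_fiberwise
    (f := ZMod.castHom h (ZMod g)) (s := Finset.univ) (t := Finset.univ)
    (fun _ _ => Finset.mem_coe.2 (Finset.mem_univ _))
  rw [Finset.sum_congr rfl fun e _ => hcard e, Finset.sum_const, smul_eq_mul, Finset.card_univ,
    Finset.card_univ, ZMod.card, ZMod.card] at hsum
  exact (Nat.div_eq_of_eq_mul_right (NeZero.pos g) hsum).symm

/-- Let `N > 1`, let `d > 1` divide `N`, and set `d' = N/d`, `d'' = gcd(d, d')`.  For a fixed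
`b ∈ (ℤ/d''ℤ)ˣ`, the sum of `W_{d·k}` over all units `k ∈ (ℤ/d'ℤ)ˣ` reducing to `b` modulo
`d''` equals `d'/d''`.  Here `W_{d·k}` is evaluated at the class in `ℤ/Nℤ` of `d` times the
canonical integer lift `(k : ZMod d').val` of `k`. -/
theorem sum_W_cusp_class (N d d' d'' : ℕ) [NeZero d'] (hN : 1 < N) (hd : 1 < d)
    (hdN : d ∣ N) (hd' : d' = N / d) (hd'' : d'' = Nat.gcd d d') (h : d'' ∣ d')
    (b : (ZMod d'')ˣ) :
    ∑ k ∈ Finset.univ.filter (fun k : (ZMod d')ˣ => ZMod.unitsMap h k = b),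
        Wfun N (((d * (k : ZMod d').val : ℕ) : ZMod N)) = d' / d'' := by
  obtain rfl : N = d * d' := by rw [hd', Nat.mul_div_cancel' hdN]
  clear hd' hdN hN
  set W : (ZMod d')ˣ → ℕ := fun k => Wfun (d * d') (((d * (k : ZMod d').val : ℕ) : ZMod (d * d')))
  have hW : ∀ k, W k = sInf {m : ℕ | 0 < m ∧ IsUnit ((↑k⁻¹ : ZMod d') - m * d)} := by
    intro k
    simp only [W, Wfun, isUnit_mul_sub_one_iff]
  have hW_mem : ∀ k, 0 < W k ∧ IsUnit ((↑k⁻¹ : ZMod d') - W k * d) := by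
    intro k
    rw [hW]
    refine Nat.sInf_mem (s := {m : ℕ | 0 < m ∧ IsUnit ((↑k⁻¹ : ZMod d') - m * d)})
      ⟨d', NeZero.pos d', ?_⟩
    rw [ZMod.natCast_self, zero_mul, sub_zero]
    exact Units.isUnit _
  have hW_min : ∀ (k : (ZMod d')ˣ) (m : ℕ), 0 < m → IsUnit ((↑k⁻¹ : ZMod d') - m * d) → W k ≤ m := by
    intro k m hm hu
    rw [hW]
    exact Nat.sInf_le ⟨hm, hu⟩
  have hd0 : ZMod.castHom h (ZMod d'') (d : ZMod d') = 0 := by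
    rw [map_natCast, ZMod.natCast_eq_zero_iff, hd'']
    exact Nat.gcd_dvd_left d d'
  have hinv : ∀ k : (ZMod d')ˣ, ZMod.unitsMap h k = b ↔
      ZMod.castHom h (ZMod d'') (↑k⁻¹ : ZMod d') = (↑b⁻¹ : ZMod d'') := by
    intro k
    rw [← inv_inj, ← map_inv, Units.ext_iff]
    rfl
  -- Both sides count the fibre of `b⁻¹`, the left one by return times of `x ↦ x - d` to units.
  rw [← card_filter_castHom_eq h (↑b⁻¹ : ZMod d'')]
  have hsigma : ∑ k ∈ Finset.univ.filter (fun k : (ZMod d')ˣ => ZMod.unitsMap h k = b), W k =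
      ((Finset.univ.filter (fun k : (ZMod d')ˣ => ZMod.unitsMap h k = b)).sigma
        fun k => Finset.range (W k)).card := by
    simp only [Finset.card_sigma, Finset.card_range]
  refine hsigma.trans (Finset.card_bij (fun p _ => (↑p.1⁻¹ : ZMod d') - p.2 * d) ?_ ?_ ?_)
  · rintro ⟨k, i⟩ hp
    simp only [Finset.mem_sigma, Finset.mem_filter_univ] at hp ⊢
    rw [map_sub, map_mul, hd0, mul_zero, sub_zero, (hinv k).1 hp.1]
  · have hle : ∀ (k l : (ZMod d')ˣ) (i j : ℕ), j < W l →
        (↑k⁻¹ : ZMod d') - i * d = ↑l⁻¹ - j * d → j ≤ i := by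
      intro k l i j hj heq
      by_contra! hij
      refine (hW_min l (j - i) (by lia) ?_).not_gt (by lia)
      have : (↑l⁻¹ : ZMod d') - ((j - i : ℕ) : ZMod d') * d = ↑k⁻¹ := by
        rw [Nat.cast_sub hij.le]
        linear_combination -heq
      rw [this]
      exact Units.isUnit _
    rintro ⟨k, i⟩ hp ⟨l, j⟩ hq heq
    simp only [Finset.mem_sigma, Finset.mem_range] at hp hq heq
    obtain rfl : i = j := le_antisymm (hle l k j i hp.2 heq.symm) (hle k l i j hq.2 heq)
    obtain rfl : k = l := inv_injective (Units.ext (sub_left_inj.1 heq))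
    rfl
  · intro y hy
    rw [Finset.mem_filter_univ] at hy
    obtain ⟨k₀, hk₀⟩ := ZMod.unitsMap_surjective h b
    have hex : ∃ t : ℕ, IsUnit (y + t * d) := by
      obtain ⟨t, ht⟩ := exists_natCast_mul_eq_of_castHom_eq hd'' h
        (((hinv k₀).1 hk₀).trans hy.symm)
      exact ⟨t, ht ▸ Units.isUnit _⟩
    classical
    obtain ⟨u, hu⟩ := Nat.find_spec hex
    have hlt : Nat.find hex < W u⁻¹ := by
      by_contra! hle
      obtain ⟨hpos, hunit⟩ := hW_mem u⁻¹
      refine Nat.find_min hex (m := Nat.find hex - W u⁻¹) (by lia) ?_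
      rw [inv_inv, hu] at hunit
      convert hunit using 1
      rw [Nat.cast_sub hle]
      ring
    refine ⟨⟨u⁻¹, Nat.find hex⟩, ?_, ?_⟩
    · simp only [Finset.mem_sigma, Finset.mem_filter_univ, Finset.mem_range]
      refine ⟨(hinv _).2 ?_, hlt⟩
      rw [inv_inv, hu, map_add, map_mul, hd0, mul_zero, add_zero, hy]
    · simp only [inv_inv, hu, add_sub_cancel_right]
end

section
/- Let M > 1 and let d, b be integers. Let a < a' be integers such that b + a·d and b + a'·d are both units in ℤ/Mℤ, while b + c·d is not a unit in ℤ/Mℤ for every integer c with a < c < a'. Then min{m ∈ ℤ_{>0} : m·v·d − 1 is a unit in ℤ/Mℤ} = a' − a, where v ∈ ℤ/Mℤ is the inverse of the class of b + a'·d. -/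
/-- If `v` is inverse to `b + a' * d` modulo `M`, then `m * v * d - 1` equals
`-v * (b + (a' - m) * d)`, so one is a unit exactly when the term `b + (a' - m) * d` of the
progression is. -/
theorem isUnit_natCast_mul_sub_one_iff {M : ℕ} {d b a' : ℤ} {v : ZMod M}
    (hv : v * ((b + a' * d : ℤ) : ZMod M) = 1) (m : ℕ) :
    IsUnit ((m : ZMod M) * v * (d : ZMod M) - 1) ↔
      IsUnit ((b + (a' - m) * d : ℤ) : ZMod M) := by
  have key : (m : ZMod M) * v * (d : ZMod M) - 1 =
      -v * ((b + (a' - m) * d : ℤ) : ZMod M) := by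
    push_cast at hv ⊢
    linear_combination hv
  rw [key, IsUnit.mul_iff, and_iff_right (IsUnit.of_mul_eq_one _ hv).neg]

/-- Let `M > 1` and `d, b ∈ ℤ`.  Let `a < a'` be integers with `b + a·d` and `b + a'·d`
units in `ℤ/Mℤ`, while `b + c·d` is not a unit for every integer `c` with `a < c < a'`.
If `v ∈ ℤ/Mℤ` is the inverse of the class of `b + a'·d`, then
`min {m ∈ ℤ_{>0} | m·v·d − 1 ∈ (ℤ/Mℤ)ˣ} = a' − a`. -/
theorem W_gap_along_progression (M : ℕ) (hM : 1 < M) (d b a a' : ℤ) (hlt : a < a')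
    (ha : IsUnit (((b + a * d : ℤ)) : ZMod M)) (ha' : IsUnit (((b + a' * d : ℤ)) : ZMod M))
    (hgap : ∀ c : ℤ, a < c → c < a' → ¬ IsUnit (((b + c * d : ℤ)) : ZMod M))
    (v : ZMod M) (hv : v * ((b + a' * d : ℤ) : ZMod M) = 1) :
    ((sInf {m : ℕ | 0 < m ∧ IsUnit ((m : ZMod M) * v * (d : ZMod M) - 1)} : ℕ) : ℤ) =
      a' - a := by
  have hleast : IsLeast {m : ℕ | 0 < m ∧ IsUnit ((m : ZMod M) * v * (d : ZMod M) - 1)}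
      (a' - a).toNat := by
    refine ⟨⟨by omega, ?_⟩, fun m ⟨hm, hunit⟩ => ?_⟩
    · rw [isUnit_natCast_mul_sub_one_iff hv, Int.toNat_of_nonneg (by omega), sub_sub_cancel]
      exact ha
    · by_contra! hlt'
      exact hgap (a' - m) (by omega) (by omega)
        ((isUnit_natCast_mul_sub_one_iff hv m).mp hunit)
  rw [hleast.csInf_eq, Int.toNat_of_nonneg (by omega)]
end

section
/- Let N > 1 and let a, b, c, d ∈ ℤ/Nℤ be such that the pair (a, b) generates the unit ideal (i.e., there exist u, v ∈ ℤ/Nℤ with a·u + b·v = 1) and likewise the pair (c, d) generates the unit ideal. Then there exists a unit w ∈ (ℤ/Nℤ)ˣ with a = w·c and b = w·d if and only if a·d = b·c in ℤ/Nℤ. -/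
/-- Let `N > 1` and `a, b, c, d ∈ ℤ/Nℤ` with both pairs `(a, b)` and `(c, d)` generating
the unit ideal.  Then `(a, b)` and `(c, d)` differ by a unit scalar iff `a·d = b·c`. -/
theorem proportional_iff_cross_mul (N : ℕ) (hN : 1 < N) (a b c d : ZMod N)
    (hab : ∃ u v : ZMod N, a * u + b * v = 1) (hcd : ∃ u v : ZMod N, c * u + d * v = 1) :
    (∃ w : (ZMod N)ˣ, a = (w : ZMod N) * c ∧ b = (w : ZMod N) * d) ↔ a * d = b * c := by
  constructor
  · rintro ⟨w, rfl, rfl⟩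
    ring
  · intro h
    obtain ⟨u, v, huv⟩ := hab
    obtain ⟨s, t, hst⟩ := hcd
    have ha : a = (a * s + b * t) * c := by linear_combination (-a) * hst + t * h
    have hb : b = (a * s + b * t) * d := by linear_combination (-b) * hst - s * h
    have hw : (a * s + b * t) * (c * u + d * v) = 1 := by
      linear_combination huv - u * ha - v * hb
    exact ⟨Units.mkOfMulEqOne _ _ hw, ha, hb⟩
end

section
/- Let N > 1 and let j be an integer with gcd(j, N) > 1. Let W_j = min{m ∈ ℤ_{>0} : m·j − 1 is a unit in ℤ/Nℤ} and M_j = W_j − 1 (so gcd(1 − j·W_j, N) = 1). If j'' is any integer with j'' ≡ (1 − j·W_j)⁻¹·j (mod N), then the matrix (S·T^{j}·S·T^{M_j})·T·(S·T^{j''}·S)⁻¹ belongs to Γ₀(N). -/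
open scoped MatrixGroups

/-- `W_j` is positive, since `m = N` lies in the set it is the minimum of. -/
lemma Wfun_pos {N : ℕ} (hN : 0 < N) (j : ZMod N) : 0 < Wfun N j := by
  have hne : {m : ℕ | 0 < m ∧ IsUnit ((m : ZMod N) * j - 1)}.Nonempty := ⟨N, hN, by simp⟩
  exact (Nat.sInf_mem hne).1

lemma S_mul_T_zpow_mul_S (k : ℤ) :
    (ModularGroup.S * ModularGroup.T ^ k * ModularGroup.S : SL(2, ℤ)).1 = !![-1, 0; k, -1] := by
  simp [ModularGroup.coe_S, ModularGroup.coe_T_zpow]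

lemma S_T_zpow_S_T_zpow_mul_inv_apply_one_zero (a b n : ℤ) :
    (ModularGroup.S * ModularGroup.T ^ a * ModularGroup.S * ModularGroup.T ^ n *
      (ModularGroup.S * ModularGroup.T ^ b * ModularGroup.S)⁻¹ : SL(2, ℤ)) 1 0 =
      b * (1 - a * n) - a := by
  rw [Matrix.SpecialLinearGroup.coe_mul, Matrix.SpecialLinearGroup.coe_inv,
    Matrix.SpecialLinearGroup.coe_mul _ (ModularGroup.T ^ n), S_mul_T_zpow_mul_S,
    S_mul_T_zpow_mul_S, ModularGroup.coe_T_zpow, Matrix.adjugate_fin_two_of, Matrix.mul_fin_two,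
    Matrix.mul_fin_two]
  simp
  ring

/-- Let `N > 1` and `j ∈ ℤ` with `gcd(j, N) > 1`; let `W = W_j` and `M_j = W_j − 1`.  If
`j''` is any integer with `j'' ≡ (1 − j·W_j)⁻¹·j (mod N)` (with `w` an integer inverse of
`1 − j·W_j` modulo `N`), then `(S·T^j·S·T^{M_j})·T·(S·T^{j''}·S)⁻¹ ∈ Γ₀(N)`. -/
theorem L_gluing_nonunit_case (N : ℕ) (hN : 1 < N) (j j'' w : ℤ)
    (hj : 1 < Int.gcd j N)
    (hw : (N : ℤ) ∣ (1 - j * (Wfun N (j : ZMod N) : ℤ)) * w - 1)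
    (hj'' : (N : ℤ) ∣ j'' - w * j) :
    (ModularGroup.S * ModularGroup.T ^ j * ModularGroup.S *
          ModularGroup.T ^ (Wfun N (j : ZMod N) - 1)) * ModularGroup.T *
        (ModularGroup.S * ModularGroup.T ^ j'' * ModularGroup.S)⁻¹
      ∈ CongruenceSubgroup.Gamma0 N := by
  have hT : ModularGroup.T ^ (Wfun N (j : ZMod N) - 1) * ModularGroup.T =
      ModularGroup.T ^ (Wfun N (j : ZMod N) : ℤ) := by
    rw [← pow_succ, Nat.sub_add_cancel (Wfun_pos (by lia) _), zpow_natCast]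
  rw [mul_assoc _ _ ModularGroup.T, hT, CongruenceSubgroup.Gamma0_mem,
    S_T_zpow_S_T_zpow_mul_inv_apply_one_zero, ZMod.intCast_zmod_eq_zero_iff_dvd]
  obtain ⟨c, hc⟩ := hw
  obtain ⟨d, hd⟩ := hj''
  exact ⟨d * (1 - j * (Wfun N (j : ZMod N) : ℤ)) + j * c, by
    linear_combination (1 - j * (Wfun N (j : ZMod N) : ℤ)) * hd + j * hc⟩
end

section
/- Let N > 1 and let j, m, j', m' be integers satisfying j·j' + (j·m − 1)·(j'·m' − 1) ≡ 0 (mod N). Then the matrix (S·T^{j}·S·T^{m})·S·(S·T^{j'}·S·T^{m'})⁻¹ belongs to Γ₀(N). -/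
open scoped MatrixGroups

/-- The matrix of `S * T ^ j * S * T ^ m`. -/
theorem ModularGroup.coe_S_mul_T_zpow_mul_S_mul_T_zpow (j m : ℤ) :
    (ModularGroup.S * ModularGroup.T ^ j * ModularGroup.S * ModularGroup.T ^ m).1 =
      !![-1, -m; j, j * m - 1] := by
  simp only [Matrix.SpecialLinearGroup.coe_mul, ModularGroup.coe_S, ModularGroup.coe_T_zpow]
  ext a b
  fin_cases a <;> fin_cases b <;> simp
  ring

/-- Let `N > 1` and `j, m, j', m' ∈ ℤ` with `j·j' + (j·m − 1)·(j'·m' − 1) ≡ 0 (mod N)`.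
Then `(S·T^j·S·T^m)·S·(S·T^{j'}·S·T^{m'})⁻¹ ∈ Γ₀(N)`. -/
theorem B_gluing_nonunit_case (N : ℕ) (hN : 1 < N) (j m j' m' : ℤ)
    (h : (N : ℤ) ∣ j * j' + (j * m - 1) * (j' * m' - 1)) :
    (ModularGroup.S * ModularGroup.T ^ j * ModularGroup.S * ModularGroup.T ^ m) *
        ModularGroup.S *
        (ModularGroup.S * ModularGroup.T ^ j' * ModularGroup.S * ModularGroup.T ^ m')⁻¹
      ∈ CongruenceSubgroup.Gamma0 N := by
  rw [CongruenceSubgroup.Gamma0_mem, ZMod.intCast_zmod_eq_zero_iff_dvd]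
  convert h using 1
  rw [Matrix.SpecialLinearGroup.coe_mul, Matrix.SpecialLinearGroup.coe_mul,
    Matrix.SpecialLinearGroup.coe_inv,
    ModularGroup.coe_S_mul_T_zpow_mul_S_mul_T_zpow,
    ModularGroup.coe_S_mul_T_zpow_mul_S_mul_T_zpow, ModularGroup.coe_S, Matrix.adjugate_fin_two_of]
  simp
  ring
end
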